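/- arXiv:1508.02260 — 5 statements merged into one kernel-verified Lean document; each statement's English description precedes it below -/
import Mathlib

section
/- Let λ = (λ₁,λ₂) be positive rational weights and let Y = f₁ ∂/∂z₁ + f₂ ∂/∂z₂ be a nonzero weighted homogeneous holomorphic polynomial vector field of weighted degree δ > 0. Then for every rational ν, the ℂ-vector space { q ∈ ℂ[z₁,z₂] : q is weighted homogeneous of weighted degree ν and Y(q) = 0 } has complex dimension at most one. -/
open MvPolynomial Complex

noncomputable section

/-- Polynomials in two complex variables `z₁, z₂`. -/
abbrev P2 := MvPolynomial (Fin 2) ℂ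

/-- Action of the vector field `Y = f₀ ∂/∂z₁ + f₁ ∂/∂z₂` on `ℂ[z₁,z₂]`. -/
def vf (f : Fin 2 → P2) (q : P2) : P2 :=
  f 0 * pderiv 0 q + f 1 * pderiv 1 q

/-- The Euler operator `X i * ∂ᵢ` scales the coefficient at `m` by `m i`. -/
theorem MvPolynomial.coeff_X_mul_pderiv {σ R : Type*} [CommSemiring R] (i : σ)
    (q : MvPolynomial σ R) (m : σ →₀ ℕ) :
    coeff m (X i * pderiv i q) = m i * coeff m q := by
  classical
  induction q using MvPolynomial.induction_on' with
  | monomial u a =>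
    rw [X_mul_pderiv_monomial, coeff_smul, coeff_monomial]
    split_ifs with h
    · simp [h]
    · simp
  | add p q hp hq => simp only [map_add, mul_add, coeff_add, hp, hq]

/-- Two polynomials over a domain of characteristic zero whose logarithmic partial derivatives
all agree have the same degree with respect to any monomial order. -/
theorem MonomialOrder.degree_eq_of_wronskian_eq_zero {σ R : Type*} [CommRing R] [IsDomain R]
    [CharZero R] (o : MonomialOrder σ) {p q : MvPolynomial σ R} (hp : p ≠ 0) (hq : q ≠ 0)
    (h : ∀ i, p * (X i * pderiv i q) = q * (X i * pderiv i p)) :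
    o.degree p = o.degree q := by
  have hle (i : σ) (r : MvPolynomial σ R) :
      o.toSyn (o.degree (X i * pderiv i r)) ≤ o.toSyn (o.degree r) := by
    rw [o.degree_le_iff]
    intro m hm
    apply o.le_degree
    rw [mem_support_iff, coeff_X_mul_pderiv] at hm
    exact mem_support_iff.2 (right_ne_zero_of_mul hm)
  ext i
  have key := congrArg (coeff (o.degree p + o.degree q)) (h i)
  rw [o.coeff_mul_of_add_of_degree_le le_rfl (hle i q), add_comm,
    o.coeff_mul_of_add_of_degree_le le_rfl (hle i p), coeff_X_mul_pderiv,
    coeff_X_mul_pderiv] at key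
  have hp' : coeff (o.degree p) p ≠ 0 := o.leadingCoeff_ne_zero_iff.2 hp
  have hq' : coeff (o.degree q) q ≠ 0 := o.leadingCoeff_ne_zero_iff.2 hq
  have : ((o.degree q i : ℕ) : R) = (o.degree p i : ℕ) := by
    apply mul_left_cancel₀ (mul_ne_zero hp' hq')
    linear_combination key
  exact_mod_cast this.symm

/-- Over a field of characteristic zero, a polynomial with the same logarithmic partial derivatives
as `q ≠ 0` is a scalar multiple of `q`. -/
theorem MvPolynomial.mem_span_singleton_of_wronskian_eq_zero {σ K : Type*} [Field K] [CharZero K]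
    (o : MonomialOrder σ) {p q : MvPolynomial σ K} (hq : q ≠ 0)
    (h : ∀ i, p * (X i * pderiv i q) = q * (X i * pderiv i p)) :
    p ∈ Submodule.span K {q} := by
  have hq' : coeff (o.degree q) q ≠ 0 := o.leadingCoeff_ne_zero_iff.2 hq
  set c : K := coeff (o.degree q) p / coeff (o.degree q) q with hc
  rw [Submodule.mem_span_singleton]
  refine ⟨c, ?_⟩
  by_contra hne
  have hr : p - c • q ≠ 0 := fun h0 => hne (sub_eq_zero.1 h0).symm
  have hdeg := o.degree_eq_of_wronskian_eq_zero hr hq fun i => by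
    simp only [map_sub, smul_eq_C_mul, Derivation.leibniz, pderiv_C, smul_eq_mul]
    linear_combination h i
  have hlead := o.leadingCoeff_ne_zero_iff.2 hr
  apply hlead
  rw [MonomialOrder.leadingCoeff, hdeg, coeff_sub, coeff_smul, hc, smul_eq_mul,
    div_mul_cancel₀ _ hq', sub_self]

theorem MvPolynomial.IsWeightedHomogeneous.weight_fin_two {R : Type*} [CommSemiring R] {lam : Fin 2 → ℚ}
    {q : MvPolynomial (Fin 2) R} {ν : ℚ} (hq : IsWeightedHomogeneous lam q ν) {m : Fin 2 →₀ ℕ}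
    (hm : coeff m q ≠ 0) : m 0 * lam 0 + m 1 * lam 1 = ν := by
  have := hq hm
  simpa [Finsupp.weight_apply, Finsupp.sum_fintype] using this

/-- Euler's identity for weighted homogeneous polynomials in two variables. -/
theorem MvPolynomial.IsWeightedHomogeneous.euler_fin_two {lam : Fin 2 → ℚ} {q : P2} {ν : ℚ}
    (hq : IsWeightedHomogeneous lam q ν) :
    C (lam 0 : ℂ) * (X 0 * pderiv 0 q) + C (lam 1 : ℂ) * (X 1 * pderiv 1 q) =
      C (ν : ℂ) * q := by
  ext m
  simp only [coeff_add, coeff_C_mul, coeff_X_mul_pderiv]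
  by_cases hm : coeff m q = 0
  · simp [hm]
  · rw [← hq.weight_fin_two hm]
    push_cast
    ring

theorem MvPolynomial.IsWeightedHomogeneous.X_mul_pderiv_eq_zero {lam : Fin 2 → ℚ} (hlam : ∀ j, 0 < lam j)
    {q : P2} (hq : IsWeightedHomogeneous lam q 0) (i : Fin 2) : X i * pderiv i q = 0 := by
  ext m
  rw [coeff_X_mul_pderiv, coeff_zero]
  by_cases hm : coeff m q = 0
  · simp [hm]
  · have h := hq.weight_fin_two hm
    have h0 : 0 ≤ (m 0 : ℚ) * lam 0 := mul_nonneg (Nat.cast_nonneg _) (hlam 0).le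
    have h1 : 0 ≤ (m 1 : ℚ) * lam 1 := mul_nonneg (Nat.cast_nonneg _) (hlam 1).le
    have hi : (m i : ℚ) * lam i = 0 := by
      fin_cases i <;> simp only [Fin.zero_eta, Fin.mk_one] <;> linarith
    have : m i = 0 := by simpa [(hlam i).ne'] using hi
    simp [this]

/-- Two polynomials annihilated by a common nonzero vector field have vanishing Jacobian. -/
theorem jacobian_eq_zero_of_vf_eq_zero {f : Fin 2 → P2} (hf : f ≠ 0) {p q : P2}
    (hp : vf f p = 0) (hq : vf f q = 0) :
    pderiv 0 p * pderiv 1 q - pderiv 1 p * pderiv 0 q = 0 := by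
  unfold vf at hp hq
  obtain ⟨j, hj⟩ := Function.ne_iff.1 hf
  apply (mul_eq_zero.1 _).resolve_left hj
  fin_cases j <;> simp only [Fin.zero_eta, Fin.mk_one]
  · linear_combination pderiv 1 q * hp - pderiv 1 p * hq
  · linear_combination pderiv 0 p * hq - pderiv 0 q * hp

theorem wronskian_eq_zero_of_jacobian_eq_zero {lam : Fin 2 → ℚ} (hlam : ∀ j, 0 < lam j) {ν : ℚ}
    {p q : P2} (hp : IsWeightedHomogeneous lam p ν) (hq : IsWeightedHomogeneous lam q ν)
    (hJ : pderiv 0 p * pderiv 1 q - pderiv 1 p * pderiv 0 q = 0) (i : Fin 2) :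
    p * (X i * pderiv i q) = q * (X i * pderiv i p) := by
  rcases eq_or_ne ν 0 with rfl | hν
  · rw [hp.X_mul_pderiv_eq_zero hlam, hq.X_mul_pderiv_eq_zero hlam, mul_zero, mul_zero]
  · have hC : (C (ν : ℂ) : P2) ≠ 0 := by simpa using hν
    apply mul_left_cancel₀ hC
    have ep := hp.euler_fin_two
    have eq := hq.euler_fin_two
    fin_cases i <;> simp only [Fin.zero_eta, Fin.mk_one]
    · linear_combination (X 0 * pderiv 0 p) * eq - (X 0 * pderiv 0 q) * ep -
        C (lam 1 : ℂ) * X 0 * X 1 * hJ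
    · linear_combination (X 1 * pderiv 1 p) * eq - (X 1 * pderiv 1 q) * ep +
        C (lam 0 : ℂ) * X 0 * X 1 * hJ

/-- the space of weighted homogeneous polynomials of a given weighted
degree `ν` annihilated by a nonzero weighted homogeneous vector field `Y` of positive
weighted degree `δ` has complex dimension at most one. -/
theorem stmt0 (lam : Fin 2 → ℚ) (hlam : ∀ j, 0 < lam j)
    (f : Fin 2 → P2) (hf : f ≠ 0) (δ : ℚ) (hδ : 0 < δ)
    (hfhom : ∀ j, IsWeightedHomogeneous lam (f j) (lam j + δ))
    (ν : ℚ) :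
    Module.rank ℂ
      ↥(Submodule.span ℂ {q : P2 | IsWeightedHomogeneous lam q ν ∧ vf f q = 0}) ≤ 1 := by
  rw [rank_submodule_le_one_iff]
  by_cases hex : ∃ q : P2, (IsWeightedHomogeneous lam q ν ∧ vf f q = 0) ∧ q ≠ 0
  · obtain ⟨q, hq, hq0⟩ := hex
    refine ⟨q, Submodule.subset_span hq, Submodule.span_le.2 fun p hp => ?_⟩
    exact mem_span_singleton_of_wronskian_eq_zero MonomialOrder.lex hq0
      (wronskian_eq_zero_of_jacobian_eq_zero hlam hp.1 hq.1
        (jacobian_eq_zero_of_vf_eq_zero hf hp.2 hq.2))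
  · push Not at hex
    refine ⟨0, zero_mem _, Submodule.span_le.2 fun p hp => ?_⟩
    rw [hex p hp]
    exact zero_mem _
end
end

section
/- Let M_P be a model hypersurface and let Y = f₁∂/∂z₁ + f₂∂/∂z₂ be a generalized rotation of M_P. Then there exist an integer M ≥ 1, integers N_j ≥ 1 (1 ≤ j ≤ M), weighted homogeneous holomorphic polynomials U_j^k, V_j^k ∈ ℂ[z₁,z₂] (1 ≤ k ≤ N_j), and nonzero complex constants c_{j,k}, d_{j,k} (1 ≤ k ≤ N_j−1), such that: (a) for each j, {U_j^1,…,U_j^{N_j}} and {V_j^1,…,V_j^{N_j}} form a symmetric pair of Y-chains, i.e. Y(U_j^{N_j}) = 0, Y(U_j^k) = c_{j,k} U_j^{k+1} for k < N_j, Y(V_j^{N_j}) = 0, Y(V_j^k) = d_{j,k} V_j^{k+1} for k < N_j, and c_{j,k} = −conj(d_{j,N_j−k}); and (b) P(z,z̄) = Σ_{j=1}^{M} Re( Σ_{k=1}^{N_j} U_j^k(z) · conj(V_j^{N_j−k+1}(z)) ) for all z ∈ ℂ², where each product U_j^k · conj(V_j^{N_j−k+1}) has total weighted degree 1. -/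
open MvPolynomial Complex

noncomputable section

/-- Polynomials in `z₁, z₂` (indexed by `Sum.inl`) and the antiholomorphic
variables `z̄₁, z̄₂` (indexed by `Sum.inr`). -/
abbrev P4 := MvPolynomial (Fin 2 ⊕ Fin 2) ℂ

/-- Substitution `(z, z̄)`: the holomorphic variables get `z`, the antiholomorphic
ones get `conj z`. -/
def mix (z : Fin 2 → ℂ) : Fin 2 ⊕ Fin 2 → ℂ :=
  Sum.elim z (fun j => (starRingEnd ℂ) (z j))

section Tensor

open TensorProduct

variable {K V W : Type*} [Field K] [AddCommGroup V] [Module K V] [AddCommGroup W] [Module K W]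

/-- Over a field every linear map is von Neumann regular. -/
lemma LinearMap.exists_quasiInverse (h : V →ₗ[K] W) : ∃ g : W →ₗ[K] V, h ∘ₗ g ∘ₗ h = h := by
  obtain ⟨s, hs⟩ := h.rangeRestrict.exists_rightInverse_of_surjective h.range_rangeRestrict
  obtain ⟨r, hr⟩ := h.range.subtype.exists_leftInverse_of_injective h.range.ker_subtype
  refine ⟨s ∘ₗ r, LinearMap.ext fun x => ?_⟩
  have h1 : r (h x) = h.rangeRestrict x := LinearMap.congr_fun hr (h.rangeRestrict x)
  have h2 := congrArg Subtype.val (LinearMap.congr_fun hs (h.rangeRestrict x))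
  simpa [h1] using h2

/-- A map into `ker h` of the form `1 - g ∘ h`; it fixes `ker h`. -/
lemma LinearMap.exists_kernel_projection (h : V →ₗ[K] V) :
    ∃ p g : V →ₗ[K] V, h ∘ₗ p = 0 ∧ p = LinearMap.id - g ∘ₗ h := by
  obtain ⟨g, hg⟩ := h.exists_quasiInverse
  exact ⟨_, g, by rw [LinearMap.comp_sub, hg, LinearMap.comp_id, sub_self], rfl⟩

/-- The tensor `∑ Xᵏ u ⊗ Zᵐ⁻ᵏ v` attached to two chains of length `m + 1`. -/
def chainTensor (X : Module.End K V) (Z : Module.End K W) (m : ℕ) (u : V) (v : W) : V ⊗[K] W :=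
  ∑ k ∈ Finset.range (m + 1), (X ^ k) u ⊗ₜ[K] (Z ^ (m - k)) v

/-- The operator on `V ⊗ W` whose values on pure tensors are chain tensors. -/
def chainOperator (X : Module.End K V) (Z : Module.End K W) (m : ℕ) : Module.End K (V ⊗[K] W) :=
  ∑ k ∈ Finset.range (m + 1), TensorProduct.map (X ^ k) (Z ^ (m - k))

lemma chainOperator_tmul (X : Module.End K V) (Z : Module.End K W) (m : ℕ) (u : V) (v : W) :
    chainOperator X Z m (u ⊗ₜ v) = chainTensor X Z m u v := by
  simp [chainOperator, chainTensor]

lemma chainOperator_telescope (X : Module.End K V) (Z : Module.End K W) (m : ℕ) :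
    (LinearMap.rTensor W X - LinearMap.lTensor V Z) * chainOperator X Z m =
      LinearMap.rTensor W (X ^ (m + 1)) - LinearMap.lTensor V (Z ^ (m + 1)) := by
  have hc : Commute (LinearMap.rTensor W X) (LinearMap.lTensor V Z) := by
    refine TensorProduct.ext' fun x y => ?_
    simp
  have h := hc.mul_geom_sum₂ (m + 1)
  rw [← LinearMap.rTensor_pow, ← LinearMap.lTensor_pow, ← h]
  congr 1
  refine Finset.sum_congr rfl fun k _ => ?_
  rw [LinearMap.rTensor_pow, LinearMap.lTensor_pow, Nat.add_sub_cancel]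
  refine TensorProduct.ext' fun x y => ?_
  simp

lemma rTensor_pow_eq_lTensor_pow {X : Module.End K V} {Z : Module.End K W} {t : V ⊗[K] W}
    (h : LinearMap.rTensor W X t = LinearMap.lTensor V Z t) (n : ℕ) :
    LinearMap.rTensor W (X ^ n) t = LinearMap.lTensor V (Z ^ n) t := by
  induction n with
  | zero => simp [Module.End.one_eq_id]
  | succ n ih =>
    have hc : LinearMap.rTensor W (X ^ n) ∘ₗ LinearMap.lTensor V Z =
        LinearMap.lTensor V Z ∘ₗ LinearMap.rTensor W (X ^ n) :=
      TensorProduct.ext' fun x y => by simp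
    rw [pow_succ, pow_succ', LinearMap.rTensor_mul, LinearMap.lTensor_mul, Module.End.mul_apply,
      Module.End.mul_apply, h, ← ih]
    exact LinearMap.congr_fun hc t

/-- A tensor on which `X ⊗ 1` and `1 ⊗ Z` agree and are nilpotent is a combination of chain
tensors. -/
lemma mem_span_chainTensor (X : Module.End K V) (Z : Module.End K W) (n : ℕ) (t : V ⊗[K] W)
    (h : LinearMap.rTensor W X t = LinearMap.lTensor V Z t)
    (hn : LinearMap.rTensor W (X ^ n) t = 0) :
    t ∈ Submodule.span K {s | ∃ m u v, (X ^ (m + 1)) u = 0 ∧ (Z ^ (m + 1)) v = 0 ∧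
      s = chainTensor X Z m u v} := by
  induction n generalizing t with
  | zero =>
    have : t = 0 := by simpa [Module.End.one_eq_id] using hn
    simp [this]
  | succ n ih =>
    obtain ⟨p, p', hp, hp'⟩ := LinearMap.exists_kernel_projection (X ^ (n + 1))
    obtain ⟨q, q', hq, hq'⟩ := LinearMap.exists_kernel_projection (Z ^ (n + 1))
    obtain ⟨g, hg⟩ := LinearMap.exists_quasiInverse ((X ^ n) ∘ₗ p)
    have hpt : LinearMap.rTensor W p t = t := by
      rw [hp', LinearMap.rTensor_sub, LinearMap.rTensor_comp]
      simp [hn]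
    have hqt : LinearMap.lTensor V q t = t := by
      rw [hq', LinearMap.lTensor_sub, LinearMap.lTensor_comp]
      simp [← rTensor_pow_eq_lTensor_pow h, hn]
    set s := TensorProduct.map (p ∘ₗ g) q t with hs
    have hXp : ∀ x, (X ^ (n + 1)) (p x) = 0 := LinearMap.congr_fun hp
    have hZq : ∀ x, (Z ^ (n + 1)) (q x) = 0 := LinearMap.congr_fun hq
    have hmem : chainOperator X Z n s ∈ Submodule.span K {s | ∃ m u v, (X ^ (m + 1)) u = 0 ∧
        (Z ^ (m + 1)) v = 0 ∧ s = chainTensor X Z m u v} := by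
      rw [hs]
      clear_value s
      clear hs hpt hqt hn h
      induction t with
      | zero => simp
      | add x y hx hy => simpa using Submodule.add_mem _ hx hy
      | tmul x y =>
        exact Submodule.subset_span ⟨n, p (g x), q y, hXp _, hZq _, by
          simp [chainOperator_tmul]⟩
    have hsub := ih (t - chainOperator X Z n s) ?_ ?_
    · simpa using Submodule.add_mem _ hsub hmem
    · have h1 := LinearMap.congr_fun (chainOperator_telescope X Z n) s
      have h2 : LinearMap.rTensor W (X ^ (n + 1)) s = 0 := by
        rw [hs, ← LinearMap.comp_apply, LinearMap.rTensor_comp_map, ← LinearMap.comp_assoc, hp]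
        simp
      have h3 : LinearMap.lTensor V (Z ^ (n + 1)) s = 0 := by
        rw [hs, ← LinearMap.comp_apply, LinearMap.lTensor_comp_map, hq]
        simp
      rw [Module.End.mul_apply, LinearMap.sub_apply, LinearMap.sub_apply, h2, h3, sub_self,
        sub_eq_zero] at h1
      rw [map_sub, map_sub, h, h1]
    · have h1 : LinearMap.rTensor W (X ^ n) * chainOperator X Z n * TensorProduct.map p q =
          TensorProduct.map ((X ^ n) ∘ₗ p) ((Z ^ n) ∘ₗ q) := by
        refine TensorProduct.ext' fun x y => ?_
        simp only [Module.End.mul_apply, TensorProduct.map_tmul, chainOperator_tmul, chainTensor,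
          map_sum, LinearMap.rTensor_tmul]
        rw [Finset.sum_range_succ', Finset.sum_eq_zero]
        · simp
        · intro k _
          rw [← Module.End.mul_apply, ← pow_add, show n + (k + 1) = k + (n + 1) by ring, pow_add,
            Module.End.mul_apply, hXp, map_zero, TensorProduct.zero_tmul]
      have h2 : s = TensorProduct.map p q (LinearMap.rTensor W g t) := by
        rw [hs, ← LinearMap.comp_apply, LinearMap.map_comp_rTensor]
      have h3 : TensorProduct.map ((X ^ n) ∘ₗ p) ((Z ^ n) ∘ₗ q) ∘ₗ LinearMap.rTensor W g =
          LinearMap.rTensor W (((X ^ n) ∘ₗ p) ∘ₗ g) ∘ₗ LinearMap.lTensor V (Z ^ n) ∘ₗ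
            LinearMap.lTensor V q := TensorProduct.ext' fun x y => by simp
      have h4 : LinearMap.rTensor W (((X ^ n) ∘ₗ p) ∘ₗ g) ∘ₗ LinearMap.rTensor W (X ^ n) ∘ₗ
          LinearMap.rTensor W p = LinearMap.rTensor W (X ^ n) ∘ₗ LinearMap.rTensor W p := by
        rw [← LinearMap.rTensor_comp, ← LinearMap.rTensor_comp, LinearMap.comp_assoc, hg]
      have h5 : LinearMap.rTensor W (X ^ n) (chainOperator X Z n s) =
          LinearMap.rTensor W (X ^ n) t :=
        calc LinearMap.rTensor W (X ^ n) (chainOperator X Z n s)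
            = (TensorProduct.map ((X ^ n) ∘ₗ p) ((Z ^ n) ∘ₗ q) ∘ₗ LinearMap.rTensor W g) t := by
              rw [h2, ← h1]
              rfl
          _ = LinearMap.rTensor W (((X ^ n) ∘ₗ p) ∘ₗ g) (LinearMap.rTensor W (X ^ n) t) := by
              rw [h3, LinearMap.comp_apply, LinearMap.comp_apply, hqt,
                rTensor_pow_eq_lTensor_pow h]
          _ = LinearMap.rTensor W (X ^ n) t := by
              simpa [hpt] using LinearMap.congr_fun h4 t
      rw [map_sub, h5, sub_self]

end Tensor

section Grading

open TensorProduct Finsupp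

variable {K σ τ : Type*} [Field K] {w : σ → ℚ} {v : τ → ℚ}

lemma tensorEquivSum_tmul (a : MvPolynomial σ K) (b : MvPolynomial τ K) :
    tensorEquivSum K σ τ K (a ⊗ₜ[K] b) = rename Sum.inl a * rename Sum.inr b := by
  have h1 : (tensorEquivSum K σ τ K).toAlgHom.comp Algebra.TensorProduct.includeLeft =
      rename Sum.inl := by
    ext i
    simp
  have h2 : (tensorEquivSum K σ τ K).toAlgHom.comp Algebra.TensorProduct.includeRight =
      rename Sum.inr := by
    ext i
    simp
  rw [← h1, ← h2]
  simp [← map_mul]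

lemma isWeightedHomogeneous_rename {w' : τ → ℚ} (g : σ → τ) (hg : w' ∘ g = w)
    {a : MvPolynomial σ K} {x : ℚ} (ha : IsWeightedHomogeneous w a x) :
    IsWeightedHomogeneous w' (rename g a) x := by
  intro d hd
  obtain ⟨e, rfl, he⟩ := coeff_rename_ne_zero g a d hd
  rw [← ha he, ← hg]
  simp [weight, linearCombination_mapDomain]

lemma isWeightedHomogeneous_tensorEquivSum_tmul {a : MvPolynomial σ K} {b : MvPolynomial τ K}
    {x y : ℚ} (ha : IsWeightedHomogeneous w a x) (hb : IsWeightedHomogeneous v b y) :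
    IsWeightedHomogeneous (Sum.elim w v) (tensorEquivSum K σ τ K (a ⊗ₜ[K] b)) (x + y) := by
  rw [tensorEquivSum_tmul]
  exact (isWeightedHomogeneous_rename _ (Sum.elim_comp_inl _ _) ha).mul
    (isWeightedHomogeneous_rename _ (Sum.elim_comp_inr _ _) hb)

/-- A polynomial map that raises weighted degrees by `δ`. -/
def RaisesWeight (w : σ → ℚ) (δ : ℚ) (X : Module.End K (MvPolynomial σ K)) : Prop :=
  ∀ q a, IsWeightedHomogeneous w q a → IsWeightedHomogeneous w (X q) (a + δ)

lemma RaisesWeight.pow {δ : ℚ} {X : Module.End K (MvPolynomial σ K)} (hX : RaisesWeight w δ X)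
    (k : ℕ) : RaisesWeight w (k * δ) (X ^ k) := by
  induction k with
  | zero => intro q a h; simpa using h
  | succ k ih =>
    intro q a h
    rw [pow_succ', Module.End.mul_apply]
    have := hX _ _ (ih q a h)
    rwa [show a + ((k + 1 : ℕ) : ℚ) * δ = a + k * δ + δ by push_cast; ring]

lemma RaisesWeight.component_comm {δ : ℚ} {X : Module.End K (MvPolynomial σ K)}
    (hX : RaisesWeight w δ X) (c : ℚ) (q : MvPolynomial σ K) :
    weightedHomogeneousComponent w (c + δ) (X q) = X (weightedHomogeneousComponent w c q) := by
  induction q using MvPolynomial.induction_on' with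
  | add p q hp hq => simp [hp, hq]
  | monomial d r =>
    have h := isWeightedHomogeneous_monomial w d r rfl
    rw [weightedHomogeneousComponent_of_mem h, weightedHomogeneousComponent_of_mem (hX _ _ h)]
    simp only [add_left_inj]
    split_ifs <;> simp

lemma RaisesWeight.mem_span_of_apply_eq_zero {δ : ℚ} {X : Module.End K (MvPolynomial σ K)}
    (hX : RaisesWeight w δ X) {u : MvPolynomial σ K} (hu : X u = 0) :
    u ∈ Submodule.span K {q | X q = 0 ∧ ∃ a, IsWeightedHomogeneous w q a} := by
  set T := Submodule.span K {q | X q = 0 ∧ ∃ a, IsWeightedHomogeneous w q a}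
  rw [← finsum_weightedHomogeneousComponent w u]
  refine finsum_induction (· ∈ T) T.zero_mem (fun _ _ hx hy => T.add_mem hx hy) fun c => ?_
  refine Submodule.subset_span ⟨?_, c, weightedHomogeneousComponent_isWeightedHomogeneous c u⟩
  rw [← hX.component_comm, hu, map_zero]

lemma chainTensor_isWeightedHomogeneous {δ : ℚ} {X : Module.End K (MvPolynomial σ K)}
    {Z : Module.End K (MvPolynomial τ K)} (hX : RaisesWeight w δ X) (hZ : RaisesWeight v δ Z)
    {a : MvPolynomial σ K} {b : MvPolynomial τ K} {x y : ℚ} (ha : IsWeightedHomogeneous w a x)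
    (hb : IsWeightedHomogeneous v b y) (m : ℕ) :
    IsWeightedHomogeneous (Sum.elim w v) (tensorEquivSum K σ τ K (chainTensor X Z m a b))
      (x + y + m * δ) := by
  rw [chainTensor, map_sum]
  refine IsWeightedHomogeneous.sum _ _ _ fun k hk => ?_
  have hk' : k ≤ m := by simpa [Nat.lt_succ_iff] using hk
  have := isWeightedHomogeneous_tensorEquivSum_tmul (hX.pow k a x ha) (hZ.pow (m - k) b y hb)
  convert this using 1
  push_cast [hk']
  ring

/-- Every homogeneous combination of chain tensors is a combination of chain tensors of
homogeneous elements. -/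
lemma mem_span_homogeneous_chainTensor {δ d : ℚ} {X : Module.End K (MvPolynomial σ K)}
    {Z : Module.End K (MvPolynomial τ K)} (hX : RaisesWeight w δ X) (hZ : RaisesWeight v δ Z)
    {t : MvPolynomial σ K ⊗[K] MvPolynomial τ K}
    (ht : IsWeightedHomogeneous (Sum.elim w v) (tensorEquivSum K σ τ K t) d)
    (hspan : t ∈ Submodule.span K {s | ∃ m u v, (X ^ (m + 1)) u = 0 ∧ (Z ^ (m + 1)) v = 0 ∧
      s = chainTensor X Z m u v}) :
    t ∈ Submodule.span K {s | ∃ (m : ℕ) (u : MvPolynomial σ K) (q : MvPolynomial τ K) (a b : ℚ),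
      (X ^ (m + 1)) u = 0 ∧ (Z ^ (m + 1)) q = 0 ∧ IsWeightedHomogeneous w u a ∧
        IsWeightedHomogeneous v q b ∧ a + b + m * δ = d ∧ s = chainTensor X Z m u q} := by
  set T := Submodule.span K {s | ∃ (m : ℕ) (u : MvPolynomial σ K) (q : MvPolynomial τ K) (a b : ℚ),
      (X ^ (m + 1)) u = 0 ∧ (Z ^ (m + 1)) q = 0 ∧ IsWeightedHomogeneous w u a ∧
        IsWeightedHomogeneous v q b ∧ a + b + m * δ = d ∧ s = chainTensor X Z m u q}
  set Φ := (tensorEquivSum K σ τ K).toLinearEquiv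
  set π : Module.End K (MvPolynomial σ K ⊗[K] MvPolynomial τ K) :=
    Φ.symm.toLinearMap ∘ₗ weightedHomogeneousComponent (Sum.elim w v) d ∘ₗ Φ.toLinearMap
  suffices hle : ∀ s ∈ Submodule.span K {s | ∃ m u v, (X ^ (m + 1)) u = 0 ∧
      (Z ^ (m + 1)) v = 0 ∧ s = chainTensor X Z m u v}, π s ∈ T by
    have h1 : π t = t := by
      change Φ.symm (weightedHomogeneousComponent _ d (tensorEquivSum K σ τ K t)) = t
      rw [weightedHomogeneousComponent_eq_self ht]
      exact Φ.symm_apply_apply t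
    exact h1 ▸ hle t hspan
  intro s hs
  induction hs using Submodule.span_induction with
  | zero => simp
  | add x y _ _ hx hy => rw [map_add]; exact T.add_mem hx hy
  | smul c x _ hx => rw [map_smul]; exact T.smul_mem c hx
  | mem s hs =>
    obtain ⟨m, u, q, hu, hq, rfl⟩ := hs
    have hu' := (hX.pow (m + 1)).mem_span_of_apply_eq_zero hu
    have hq' := (hZ.pow (m + 1)).mem_span_of_apply_eq_zero hq
    rw [← chainOperator_tmul]
    clear hu hq
    induction hu', hq' using Submodule.span_induction₂ with
    | zero_left => simp
    | zero_right => simp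
    | add_left x y z _ _ _ hx hy =>
      rw [TensorProduct.add_tmul, map_add, map_add]; exact T.add_mem hx hy
    | add_right x y z _ _ _ hx hy =>
      rw [TensorProduct.tmul_add, map_add, map_add]; exact T.add_mem hx hy
    | smul_left c x y _ _ hx =>
      rw [← TensorProduct.smul_tmul', map_smul, map_smul]; exact T.smul_mem c hx
    | smul_right c x y _ _ hx =>
      rw [TensorProduct.tmul_smul, map_smul, map_smul]; exact T.smul_mem c hx
    | mem_mem u q hu hq =>
      obtain ⟨hu, a, ha⟩ := hu
      obtain ⟨hq, b, hb⟩ := hq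
      rw [chainOperator_tmul]
      have h : IsWeightedHomogeneous (Sum.elim w v) (Φ (chainTensor X Z m u q)) (a + b + m * δ) :=
        chainTensor_isWeightedHomogeneous hX hZ ha hb m
      change Φ.symm (weightedHomogeneousComponent _ d (Φ (chainTensor X Z m u q))) ∈ T
      by_cases hd : d = a + b + m * δ
      · rw [weightedHomogeneousComponent_eq_self (hd ▸ h), Φ.symm_apply_apply]
        exact Submodule.subset_span ⟨m, u, q, a, b, hu, hq, ha, hb, hd.symm, rfl⟩
      · rw [IsWeightedHomogeneous.weightedHomogeneousComponent_ne d h hd, map_zero]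
        exact T.zero_mem

lemma mem_span_homogeneous_tmul {d : ℚ} {P : MvPolynomial (σ ⊕ τ) K}
    (hP : IsWeightedHomogeneous (Sum.elim w v) P d) :
    (tensorEquivSum K σ τ K).symm P ∈ Submodule.span K {s | ∃ a b x y,
      IsWeightedHomogeneous w a x ∧ IsWeightedHomogeneous v b y ∧ x + y = d ∧
        s = a ⊗ₜ[K] b} := by
  induction hP using IsWeightedHomogeneous.induction_on with
  | zero => simp
  | add p q _ _ hp hq => rw [map_add]; exact Submodule.add_mem _ hp hq
  | monomial e r he =>
    obtain ⟨e₁, e₂, rfl⟩ : ∃ e₁ e₂, e = mapDomain Sum.inl e₁ + mapDomain Sum.inr e₂ := by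
      refine ⟨(sumFinsuppEquivProdFinsupp e).1, (sumFinsuppEquivProdFinsupp e).2, ?_⟩
      ext (i | i) <;>
        simp [mapDomain_apply Sum.inl_injective, mapDomain_apply Sum.inr_injective,
          mapDomain_of_notMem_range]
    refine Submodule.subset_span ⟨monomial e₁ r, monomial e₂ 1, _, _,
      isWeightedHomogeneous_monomial w e₁ r rfl, isWeightedHomogeneous_monomial v e₂ 1 rfl, ?_, ?_⟩
    · rw [← he, map_add]
      simp [weight, linearCombination_mapDomain]
    · rw [AlgEquiv.symm_apply_eq, tensorEquivSum_tmul, rename_monomial, rename_monomial,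
        monomial_mul, mul_one]

lemma eq_zero_of_isWeightedHomogeneous_neg (hw : ∀ i, 0 ≤ w i) {q : MvPolynomial σ K} {a : ℚ}
    (hq : IsWeightedHomogeneous w q a) (ha : a < 0) : q = 0 := by
  refine hq.eq_zero_of_no_monomials fun d hd => ?_
  have : 0 ≤ weight w d := by
    rw [weight_apply]
    exact Finset.sum_nonneg fun i _ => nsmul_nonneg (hw i) _
  linarith

/-- The projection onto the monomials of weighted degree at most `c`. -/
lemma exists_weight_truncation (w : σ → ℚ) (c : ℚ) :
    ∃ R : Module.End K (MvPolynomial σ K), ∀ q a, IsWeightedHomogeneous w q a →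
      R q = if a ≤ c then q else 0 := by
  refine ⟨(basisMonomials σ K).constr K fun e => if weight w e ≤ c then monomial e 1 else 0,
    fun q a hq => ?_⟩
  induction hq using IsWeightedHomogeneous.induction_on with
  | zero => simp
  | add p q _ _ hp hq => rw [map_add, hp, hq]; split_ifs <;> simp
  | monomial e r he =>
    have h1 : monomial e r = r • basisMonomials σ K e := by simp [smul_monomial]
    rw [h1, map_smul, Module.Basis.constr_basis, ← he]
    split_ifs <;> simp

/-- Operators raising the weights on both sides are nilpotent on a homogeneous tensor on which
they agree. -/
lemma exists_rTensor_pow_eq_zero (hw : ∀ i, 0 ≤ w i) (hv : ∀ i, 0 ≤ v i) {δ d : ℚ} (hδ : 0 < δ)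
    {X : Module.End K (MvPolynomial σ K)} {Z : Module.End K (MvPolynomial τ K)}
    (hX : RaisesWeight w δ X) {P : MvPolynomial (σ ⊕ τ) K}
    (hP : IsWeightedHomogeneous (Sum.elim w v) P d)
    (h : LinearMap.rTensor (MvPolynomial τ K) X ((tensorEquivSum K σ τ K).symm P) =
      LinearMap.lTensor (MvPolynomial σ K) Z ((tensorEquivSum K σ τ K).symm P)) :
    ∃ n, LinearMap.rTensor (MvPolynomial τ K) (X ^ n) ((tensorEquivSum K σ τ K).symm P) = 0 := by
  obtain ⟨n, hn⟩ := exists_nat_gt (d / δ)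
  rw [div_lt_iff₀ hδ] at hn
  obtain ⟨R, hR⟩ := exists_weight_truncation (K := K) w d
  have ht := mem_span_homogeneous_tmul hP
  set t := (tensorEquivSum K σ τ K).symm P
  have h1 : LinearMap.rTensor (MvPolynomial τ K) R t = t ∧
      LinearMap.rTensor (MvPolynomial τ K) R (LinearMap.rTensor _ (X ^ n) t) = 0 := by
    clear_value t
    clear h
    induction ht using Submodule.span_induction with
    | zero => simp
    | add x y _ _ hx hy => simp only [map_add, hx, hy, add_zero, and_self]
    | smul c x _ hx => simp only [map_smul, hx, smul_zero, and_self]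
    | mem s hs =>
      obtain ⟨a, b, x, y, ha, hb, hxy, rfl⟩ := hs
      rw [LinearMap.rTensor_tmul, LinearMap.rTensor_tmul, LinearMap.rTensor_tmul, hR _ _ ha,
        hR _ _ (hX.pow n a x ha)]
      constructor
      · split_ifs with hx
        · rfl
        · rw [eq_zero_of_isWeightedHomogeneous_neg hv hb (by linarith)]
          simp
      · split_ifs with hx
        · rw [eq_zero_of_isWeightedHomogeneous_neg hw ha (by linarith)]
          simp
        · simp
  refine ⟨n, ?_⟩
  have hc : LinearMap.rTensor (MvPolynomial τ K) R ∘ₗ LinearMap.lTensor _ (Z ^ n) =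
      LinearMap.lTensor _ (Z ^ n) ∘ₗ LinearMap.rTensor (MvPolynomial τ K) R :=
    TensorProduct.ext' fun x y => by simp
  have h2 := LinearMap.congr_fun hc t
  rw [LinearMap.comp_apply, LinearMap.comp_apply, h1.1, ← rTensor_pow_eq_lTensor_pow h, h1.2] at h2
  exact h2.symm

end Grading

section RealPolynomials

open TensorProduct

lemma eq_zero_of_eval_mix {Q : P4} (h : ∀ z, eval (mix z) Q = 0) : Q = 0 := by
  set S : P4 →ₐ[ℂ] P4 := aeval (Sum.elim (fun j => X (Sum.inl j) + C I * X (Sum.inr j))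
    (fun j => X (Sum.inl j) - C I * X (Sum.inr j))) with hS
  have hev : ∀ x : Fin 2 ⊕ Fin 2 → ℂ, eval x (S Q) =
      eval (Sum.elim (fun j => x (Sum.inl j) + I * x (Sum.inr j))
        (fun j => x (Sum.inl j) - I * x (Sum.inr j))) Q := by
    intro x
    clear h
    induction Q using MvPolynomial.induction_on with
    | C a => simp
    | add p q hp hq => simp [hp, hq]
    | mul_X p i hp =>
      rw [map_mul, map_mul, map_mul, hp]
      cases i <;> simp [hS]
  have hSQ : S Q = 0 := by
    refine funext_set (fun _ => Set.range ((↑) : ℝ → ℂ))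
      (fun _ => Set.infinite_range_of_injective ofReal_injective) fun x hx => ?_
    choose y hy using fun i => hx i (Set.mem_univ i)
    rw [hev, map_zero, ← h fun j => x (Sum.inl j) + I * x (Sum.inr j)]
    congr 1
    congr 1
    ext (j | j)
    · simp [mix]
    · simp [mix, ← hy, sub_eq_add_neg]
  refine MvPolynomial.funext fun y => ?_
  have h2 := hev (Sum.elim (fun j => (y (Sum.inl j) + y (Sum.inr j)) / 2)
    (fun j => (y (Sum.inl j) - y (Sum.inr j)) / (2 * I)))
  rw [hSQ, map_zero] at h2
  rw [map_zero, h2]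
  congr 1
  congr 1
  ext (j | j)
  · simp
    field_simp
    ring
  · simp
    field_simp
    ring

/-- The polynomial whose values at `(z, z̄)` are the conjugates of those of `Q`. -/
def conjSwap (Q : P4) : P4 := rename Sum.swap (map (starRingEnd ℂ) Q)

lemma eval_conj_map {σ : Type*} (x : σ → ℂ) (q : MvPolynomial σ ℂ) :
    eval (fun i => (starRingEnd ℂ) (x i)) (map (starRingEnd ℂ) q) =
      (starRingEnd ℂ) (eval x q) := by
  rw [eval_map]
  exact (eval₂_comp (starRingEnd ℂ) x q).symm

lemma eval_mix_conjSwap (z : Fin 2 → ℂ) (Q : P4) :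
    eval (mix z) (conjSwap Q) = (starRingEnd ℂ) (eval (mix z) Q) := by
  rw [conjSwap, eval_rename, ← eval_conj_map]
  congr 1
  congr 1
  ext (j | j) <;> simp [mix]

lemma conjSwap_eq_self {P : P4} (hreal : ∀ z, (eval (mix z) P).im = 0) : conjSwap P = P := by
  rw [← sub_eq_zero]
  refine eq_zero_of_eval_mix fun z => ?_
  rw [map_sub, eval_mix_conjSwap, conj_eq_iff_im.mpr (hreal z), sub_self]

/-- The vector field `Y` acting on the holomorphic variables. -/
def holVf (f : Fin 2 → P2) (Q : P4) : P4 :=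
  rename Sum.inl (f 0) * pderiv (Sum.inl 0) Q + rename Sum.inl (f 1) * pderiv (Sum.inl 1) Q

/-- The vector field `Y` acting on the antiholomorphic variables. -/
def antiVf (f : Fin 2 → P2) (Q : P4) : P4 :=
  rename Sum.inr (f 0) * pderiv (Sum.inr 0) Q + rename Sum.inr (f 1) * pderiv (Sum.inr 1) Q

/-- The vector field with conjugated coefficients. -/
def conjVf (f : Fin 2 → P2) (j : Fin 2) : P2 := map (starRingEnd ℂ) (f j)

lemma map_conj_vf (f : Fin 2 → P2) (q : P2) :
    map (starRingEnd ℂ) (vf f q) = vf (conjVf f) (map (starRingEnd ℂ) q) := by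
  simp [vf, conjVf, pderiv_map]

lemma conjSwap_holVf (f : Fin 2 → P2) (Q : P4) :
    conjSwap (holVf f Q) = antiVf (conjVf f) (conjSwap Q) := by
  have hs : Function.Injective (Sum.swap : Fin 2 ⊕ Fin 2 → Fin 2 ⊕ Fin 2) :=
    Sum.swap_leftInverse.injective
  have h : ∀ j, pderiv (Sum.inr j) (conjSwap Q) = conjSwap (pderiv (Sum.inl j) Q) := fun j => by
    rw [conjSwap, conjSwap, ← pderiv_map, ← pderiv_rename hs, Sum.swap_inl]
  rw [antiVf, h, h]
  simp only [conjSwap, holVf, conjVf, map_add, map_mul, map_rename, rename_rename]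
  rfl

lemma holVf_add_antiVf_eq_zero {P : P4} (hreal : ∀ z, (eval (mix z) P).im = 0) {f : Fin 2 → P2}
    (htan : ∀ z : Fin 2 → ℂ,
      (eval z (f 0) * eval (mix z) (pderiv (Sum.inl 0) P) +
       eval z (f 1) * eval (mix z) (pderiv (Sum.inl 1) P)).re = 0) :
    holVf f P + antiVf (conjVf f) P = 0 := by
  have h : antiVf (conjVf f) P = conjSwap (holVf f P) := by
    rw [conjSwap_holVf, conjSwap_eq_self hreal]
  rw [h]
  refine eq_zero_of_eval_mix fun z => ?_
  rw [map_add, eval_mix_conjSwap, add_conj, ofReal_eq_zero]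
  refine mul_eq_zero_of_right 2 ((congrArg re ?_).trans (htan z))
  simp only [holVf, map_add, map_mul, eval_rename]
  rfl

/-- `vf f` as a linear map. -/
def vfEnd (f : Fin 2 → P2) : Module.End ℂ P2 where
  toFun := vf f
  map_add' p q := by simp [vf]; ring
  map_smul' c p := by simp [vf]

lemma vfEnd_raisesWeight {μ : Fin 2 → ℚ} {f : Fin 2 → P2} {δ : ℚ}
    (hf : ∀ j, IsWeightedHomogeneous μ (f j) (μ j + δ)) : RaisesWeight μ δ (vfEnd f) := by
  intro q a hq
  have h : ∀ j, IsWeightedHomogeneous μ (f j * pderiv j q) (a + δ) := fun j => by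
    have := (hf j).mul (hq.pderiv (sub_add_cancel a (μ j)))
    rwa [show μ j + δ + (a - μ j) = a + δ by ring] at this
  exact (h 0).add (h 1)

lemma isWeightedHomogeneous_map_conj {σ : Type*} {w : σ → ℚ} {q : MvPolynomial σ ℂ} {a : ℚ}
    (h : IsWeightedHomogeneous w q a) :
    IsWeightedHomogeneous w (map (starRingEnd ℂ) q) a := by
  intro d hd
  rw [coeff_map] at hd
  exact h fun h0 => hd (by rw [h0, map_zero])

lemma pderiv_inl_rename_inr (j : Fin 2) (q : P2) :
    pderiv (Sum.inl j : Fin 2 ⊕ Fin 2) (rename Sum.inr q) = 0 := by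
  induction q using MvPolynomial.induction_on with
  | C a => simp
  | add p q hp hq => simp [hp, hq]
  | mul_X p a h => simp [h, pderiv_X]

lemma pderiv_inr_rename_inl (j : Fin 2) (q : P2) :
    pderiv (Sum.inr j : Fin 2 ⊕ Fin 2) (rename Sum.inl q) = 0 := by
  induction q using MvPolynomial.induction_on with
  | C a => simp
  | add p q hp hq => simp [hp, hq]
  | mul_X p a h => simp [h, pderiv_X]

lemma tensorEquivSum_rTensor_vfEnd (f : Fin 2 → P2) (t : P2 ⊗[ℂ] P2) :
    tensorEquivSum ℂ (Fin 2) (Fin 2) ℂ (LinearMap.rTensor P2 (vfEnd f) t) =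
      holVf f (tensorEquivSum ℂ (Fin 2) (Fin 2) ℂ t) := by
  induction t with
  | zero => simp [holVf]
  | add x y hx hy =>
    rw [map_add, map_add, hx, hy]
    simp only [holVf, map_add]
    ring
  | tmul a b =>
    rw [LinearMap.rTensor_tmul, tensorEquivSum_tmul, tensorEquivSum_tmul]
    simp only [holVf, Derivation.leibniz, pderiv_inl_rename_inr,
      pderiv_rename Sum.inl_injective, smul_eq_mul]
    change rename Sum.inl (vf f a) * _ = _
    simp only [vf, map_add, map_mul]
    ring

lemma tensorEquivSum_lTensor_vfEnd (f : Fin 2 → P2) (t : P2 ⊗[ℂ] P2) :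
    tensorEquivSum ℂ (Fin 2) (Fin 2) ℂ (LinearMap.lTensor P2 (vfEnd f) t) =
      antiVf f (tensorEquivSum ℂ (Fin 2) (Fin 2) ℂ t) := by
  induction t with
  | zero => simp [antiVf]
  | add x y hx hy =>
    rw [map_add, map_add, hx, hy]
    simp only [antiVf, map_add]
    ring
  | tmul a b =>
    rw [LinearMap.lTensor_tmul, tensorEquivSum_tmul, tensorEquivSum_tmul]
    simp only [antiVf, Derivation.leibniz, pderiv_inr_rename_inl,
      pderiv_rename Sum.inr_injective, smul_eq_mul]
    change _ * rename Sum.inr (vf f b) = _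
    simp only [vf, map_add, map_mul]
    ring

end RealPolynomials

section Decomposition

open TensorProduct

/-- A real-valued polynomial with a generalized rotation is a finite sum of homogeneous chain
tensors of total weight one. -/
lemma exists_chainTensor_decomposition {μ : Fin 2 → ℚ} (hμ : ∀ i, 0 ≤ μ i) {P : P4}
    (hreal : ∀ z : Fin 2 → ℂ, (eval (mix z) P).im = 0)
    (hPhom : IsWeightedHomogeneous (Sum.elim μ μ) P 1) {f : Fin 2 → P2} {δ : ℚ} (hδ : 0 < δ)
    (hfhom : ∀ j, IsWeightedHomogeneous μ (f j) (μ j + δ))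
    (htan : ∀ z : Fin 2 → ℂ,
      (eval z (f 0) * eval (mix z) (pderiv (Sum.inl 0) P) +
       eval z (f 1) * eval (mix z) (pderiv (Sum.inl 1) P)).re = 0) :
    ∃ (M : ℕ) (m : ℕ → ℕ) (u q : ℕ → P2),
      (∀ j, (vfEnd f ^ (m j + 1)) (u j) = 0 ∧ ((-vfEnd (conjVf f)) ^ (m j + 1)) (q j) = 0 ∧
        ∃ a b, IsWeightedHomogeneous μ (u j) a ∧ IsWeightedHomogeneous μ (q j) b ∧
          a + b + m j * δ = 1) ∧
      P = ∑ j ∈ Finset.range (M + 1), tensorEquivSum ℂ (Fin 2) (Fin 2) ℂ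
        (chainTensor (vfEnd f) (-vfEnd (conjVf f)) (m j) (u j) (q j)) := by
  have hX := vfEnd_raisesWeight hfhom
  have hZ : RaisesWeight μ δ (-vfEnd (conjVf f)) := fun q a hq =>
    (vfEnd_raisesWeight (f := conjVf f)
      (fun j => isWeightedHomogeneous_map_conj (hfhom j)) q a hq).neg
  set Φ := tensorEquivSum ℂ (Fin 2) (Fin 2) ℂ with hΦ
  have ht : LinearMap.rTensor P2 (vfEnd f) (Φ.symm P) =
      LinearMap.lTensor P2 (-vfEnd (conjVf f)) (Φ.symm P) := by
    apply Φ.injective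
    rw [LinearMap.lTensor_neg, LinearMap.neg_apply, map_neg, tensorEquivSum_rTensor_vfEnd,
      tensorEquivSum_lTensor_vfEnd, ← hΦ, AlgEquiv.apply_symm_apply]
    exact eq_neg_of_add_eq_zero_left (holVf_add_antiVf_eq_zero hreal htan)
  obtain ⟨n, hn⟩ := exists_rTensor_pow_eq_zero hμ hμ hδ hX hPhom ht
  have hspan := mem_span_homogeneous_chainTensor hX hZ (d := 1) (t := Φ.symm P)
    (by rwa [← hΦ, AlgEquiv.apply_symm_apply]) (mem_span_chainTensor _ _ n _ ht hn)
  obtain ⟨M, c, s, hs⟩ := Submodule.mem_span_set'.mp hspan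
  choose m u q a b hu hq ha hb hd hE using fun i => (s i).2
  refine ⟨M, fun j => if h : j < M then m ⟨j, h⟩ else 0,
    fun j => if h : j < M then c ⟨j, h⟩ • u ⟨j, h⟩ else 0,
    fun j => if h : j < M then q ⟨j, h⟩ else 0, fun j => ?_, ?_⟩
  · by_cases h : j < M
    · simp only [h, dite_true]
      refine ⟨by rw [map_smul, hu, smul_zero], hq _, a ⟨j, h⟩, b ⟨j, h⟩, ?_, hb _, hd _⟩
      rw [smul_eq_C_mul]
      exact (ha _).C_mul _
    · simp only [h, dite_false, map_zero, true_and]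
      exact ⟨1, 0, isWeightedHomogeneous_zero _ _ _, isWeightedHomogeneous_zero _ _ _, by simp⟩
  · rw [Finset.sum_range_succ, Finset.sum_range]
    simp only [Fin.is_lt, dite_true, Fin.eta, lt_irrefl, dite_false]
    rw [show chainTensor (vfEnd f) (-vfEnd (conjVf f)) 0 0 0 = 0 by simp [chainTensor], map_zero,
      add_zero]
    rw [← Φ.apply_symm_apply P, ← hs, map_sum]
    refine Finset.sum_congr rfl fun i _ => ?_
    rw [hE, ← chainOperator_tmul, ← chainOperator_tmul, ← TensorProduct.smul_tmul', map_smul,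
      map_smul, map_smul]

lemma starRingEnd_comp_starRingEnd : (starRingEnd ℂ).comp (starRingEnd ℂ) = RingHom.id ℂ :=
  RingHom.ext fun x => conj_conj x

lemma sum_Icc_one_eq_sum_range (g : ℕ → ℂ) (n : ℕ) :
    ∑ k ∈ Finset.Icc 1 n, g k = ∑ k ∈ Finset.range n, g (k + 1) := by
  rw [Finset.range_eq_Ico, Finset.sum_Ico_add' g 0 n 1]
  rfl

lemma map_conj_vfEnd_pow (f : Fin 2 → P2) (k : ℕ) (q : P2) :
    map (starRingEnd ℂ) (((-vfEnd (conjVf f)) ^ k) q) =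
      ((-vfEnd f) ^ k) (map (starRingEnd ℂ) q) := by
  have hcc : conjVf (conjVf f) = f := by
    funext j
    rw [conjVf, conjVf, MvPolynomial.map_map, starRingEnd_comp_starRingEnd, MvPolynomial.map_id]
  induction k with
  | zero => simp
  | succ k ih =>
    rw [pow_succ', pow_succ', Module.End.mul_apply, Module.End.mul_apply, ← ih]
    change MvPolynomial.map _ (-vf (conjVf f) _) = -vf f _
    rw [map_neg, map_conj_vf, hcc]

lemma eval_mix_chainTensor (f : Fin 2 → P2) (m : ℕ) (u q : P2) (z : Fin 2 → ℂ) :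
    eval (mix z) (tensorEquivSum ℂ (Fin 2) (Fin 2) ℂ
      (chainTensor (vfEnd f) (-vfEnd (conjVf f)) m u q)) =
    ∑ k ∈ Finset.range (m + 1), eval z ((vfEnd f ^ k) u) *
      (starRingEnd ℂ) (eval z (((-vfEnd f) ^ (m - k)) (map (starRingEnd ℂ) q))) := by
  rw [chainTensor, map_sum, map_sum]
  refine Finset.sum_congr rfl fun k _ => ?_
  rw [tensorEquivSum_tmul, map_mul, eval_rename, eval_rename, ← map_conj_vfEnd_pow,
    ← eval_conj_map, MvPolynomial.map_map,
    starRingEnd_comp_starRingEnd, MvPolynomial.map_id]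
  rfl

end Decomposition

/-- if `Y` is a generalized rotation of the model hypersurface
`M_P = {Im w = P(z,z̄)}`, then `P` decomposes as a sum of terms
`Re (Σ_k U_j^k conj (V_j^{N_j-k+1}))` built from symmetric pairs of `Y`-chains. -/
theorem stmt4 (μ : Fin 2 → ℚ) (hμ0 : 0 < μ 1) (hμ12 : μ 1 ≤ μ 0) (hμ1 : μ 0 ≤ 1 / 2)
    (P : P4)
    -- `P(z,z̄)` is real valued
    (hreal : ∀ z : Fin 2 → ℂ, (eval (mix z) P).im = 0)
    -- `P` is weighted homogeneous of weighted degree 1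
    (hPhom : IsWeightedHomogeneous (Sum.elim μ μ) P 1)
    -- `P` has no pluriharmonic terms
    (hplh : ∀ m ∈ P.support, (∃ i, m (Sum.inl i) ≠ 0) ∧ (∃ i, m (Sum.inr i) ≠ 0))
    -- `Y = f₁ ∂/∂z₁ + f₂ ∂/∂z₂` is a generalized rotation of `M_P`:
    (f : Fin 2 → P2) (hf : f ≠ 0) (δ : ℚ) (hδ : 0 < δ)
    (hfhom : ∀ j, IsWeightedHomogeneous μ (f j) (μ j + δ))
    (htan : ∀ z : Fin 2 → ℂ,
      (eval z (f 0) * eval (mix z) (pderiv (Sum.inl 0) P) +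
       eval z (f 1) * eval (mix z) (pderiv (Sum.inl 1) P)).re = 0) :
    ∃ (M : ℕ) (N : ℕ → ℕ) (U V : ℕ → ℕ → P2) (cc dd : ℕ → ℕ → ℂ),
      1 ≤ M ∧
      (∀ j, 1 ≤ j → j ≤ M → 1 ≤ N j) ∧
      (∀ j, 1 ≤ j → j ≤ M →
        -- `{U_j^k}` and `{V_j^k}` form a symmetric pair of `Y`-chains:
        vf f (U j (N j)) = 0 ∧ vf f (V j (N j)) = 0 ∧
        (∀ k, 1 ≤ k → k ≤ N j - 1 →
          cc j k ≠ 0 ∧ dd j k ≠ 0 ∧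
          vf f (U j k) = C (cc j k) * U j (k + 1) ∧
          vf f (V j k) = C (dd j k) * V j (k + 1) ∧
          cc j k = - (starRingEnd ℂ) (dd j (N j - k))) ∧
        -- the `U_j^k`, `V_j^k` are weighted homogeneous and each product
        -- `U_j^k · conj (V_j^{N_j-k+1})` has total weighted degree 1:
        (∀ k, 1 ≤ k → k ≤ N j →
          ∃ a b : ℚ, a + b = 1 ∧
            IsWeightedHomogeneous μ (U j k) a ∧
            IsWeightedHomogeneous μ (V j (N j - k + 1)) b)) ∧
      -- the decomposition of `P`:
      (∀ z : Fin 2 → ℂ,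
        eval (mix z) P =
          ((∑ j ∈ Finset.Icc 1 M,
              (∑ k ∈ Finset.Icc 1 (N j),
                eval z (U j k) * (starRingEnd ℂ) (eval z (V j (N j - k + 1)))).re : ℝ) : ℂ)) := by
  have hμ : ∀ i, 0 ≤ μ i := Fin.forall_fin_two.mpr ⟨(hμ0.trans_le hμ12).le, hμ0.le⟩
  obtain ⟨M, m, u, q, h, hP⟩ := exists_chainTensor_decomposition hμ hreal hPhom hδ hfhom htan
  have hX := vfEnd_raisesWeight hfhom
  have hX' : RaisesWeight μ δ (-vfEnd f) := fun q a hq => (hX q a hq).neg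
  have hone : ∀ p, vfEnd f p = vf f p := fun _ => rfl
  refine ⟨M + 1, fun j => m (j - 1) + 1, fun j k => (vfEnd f ^ (k - 1)) (u (j - 1)),
    fun j k => ((-vfEnd f) ^ (k - 1)) (map (starRingEnd ℂ) (q (j - 1))),
    fun _ _ => 1, fun _ _ => -1, by omega, fun j _ _ => by simp, fun j _ _ => ?_, fun z => ?_⟩
  · obtain ⟨hu, hq, a, b, ha, hb, hab⟩ := h (j - 1)
    refine ⟨?_, ?_, ?_, ?_⟩
    · rw [← hone, ← Module.End.mul_apply, ← pow_succ']
      exact hu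
    · rw [← hone, ← neg_eq_zero, ← LinearMap.neg_apply, ← Module.End.mul_apply, ← pow_succ',
        ← map_conj_vfEnd_pow]
      simp only [add_tsub_cancel_right, hq, map_zero]
    · intro k hk _
      obtain ⟨k, rfl⟩ := Nat.exists_eq_add_of_le' hk
      refine ⟨one_ne_zero, by simp, ?_, ?_, by simp⟩
      · rw [← hone, ← Module.End.mul_apply, ← pow_succ']
        simp
      · rw [← hone, ← neg_inj, ← LinearMap.neg_apply, ← Module.End.mul_apply, ← pow_succ']
        simp
    · intro k hk hkm
      obtain ⟨k, rfl⟩ := Nat.exists_eq_add_of_le' hk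
      obtain ⟨l, hl⟩ := Nat.exists_eq_add_of_le (Nat.le_of_succ_le_succ hkm)
      refine ⟨_, _, ?_, hX.pow _ _ _ ha, hX'.pow _ _ _ (isWeightedHomogeneous_map_conj hb)⟩
      rw [show k + 1 - 1 = k by omega, show m (j - 1) + 1 - (k + 1) + 1 - 1 = l by omega, ← hab, hl]
      push_cast
      ring
  · have hsum : eval (mix z) P = ∑ j ∈ Finset.Icc 1 (M + 1), ∑ k ∈ Finset.Icc 1 (m (j - 1) + 1),
        eval z ((vfEnd f ^ (k - 1)) (u (j - 1))) * (starRingEnd ℂ) (eval z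
          (((-vfEnd f) ^ (m (j - 1) + 1 - k + 1 - 1)) (map (starRingEnd ℂ) (q (j - 1))))) := by
      conv_lhs => rw [hP, map_sum]
      rw [sum_Icc_one_eq_sum_range]
      refine Finset.sum_congr rfl fun j _ => ?_
      rw [eval_mix_chainTensor, sum_Icc_one_eq_sum_range]
      simp only [add_tsub_cancel_right, Nat.add_sub_add_right]
    rw [← re_sum, ← hsum]
    exact Complex.ext rfl (hreal z)
end
end

section
/- Fix rational weights μ = (μ₁,μ₂) with 0 < μ₂ ≤ μ₁ ≤ 1/2, and let Y = f₁∂/∂z₁ + f₂∂/∂z₂ be a nonzero vector field where f_j ∈ ℂ[z₁,z₂] is weighted homogeneous of weighted degree μ_j + δ for some rational δ > 0. Suppose P(z,z̄) = Σ_{j=1}^{M} Re( Σ_{k=1}^{N_j} U_j^k(z) · conj(V_j^{N_j−k+1}(z)) ), where for each j the sequences {U_j^1,…,U_j^{N_j}} and {V_j^1,…,V_j^{N_j}} of weighted homogeneous holomorphic polynomials form a symmetric pair of Y-chains. Then Re( f₁(z) ∂P/∂z₁(z,z̄) + f₂(z) ∂P/∂z₂(z,z̄) ) = 0 for all z ∈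 ℂ²; that is, Y is an infinitesimal CR automorphism of the model hypersurface M_P = {Im w = P(z,z̄)} (a generalized rotation). -/
open MvPolynomial Complex

noncomputable section

theorem eval_bind₁_apply {σ τ R : Type*} [CommSemiring R] (x : τ → R)
    (g : σ → MvPolynomial τ R) (p : MvPolynomial σ R) :
    eval x (bind₁ g p) = eval (fun i => eval x (g i)) p := by
  induction p using MvPolynomial.induction_on <;> simp_all

/-- A polynomial in `z, z̄` is determined by its values at the points `(z, z̄)`. -/
theorem P4.ext_mix {P Q : P4} (h : ∀ z, eval (mix z) P = eval (mix z) Q) : P = Q := by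
  let g : Fin 2 ⊕ Fin 2 → P4 :=
    Sum.elim (fun j => X (Sum.inl j) + C I * X (Sum.inr j))
      (fun j => X (Sum.inl j) - C I * X (Sum.inr j))
  have key : bind₁ g P = bind₁ g Q := by
    refine MvPolynomial.funext_set (fun _ => Set.range ((↑) : ℝ → ℂ))
      (fun _ => Set.infinite_range_of_injective Complex.ofReal_injective) ?_
    intro x hx
    choose r hr using fun i => hx i (Set.mem_univ i)
    obtain rfl : x = fun i => (r i : ℂ) := funext fun i => (hr i).symm
    have hg : (fun i => eval (fun i => (r i : ℂ)) (g i)) =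
        mix (fun j => r (Sum.inl j) + I * r (Sum.inr j)) := by
      funext i
      rcases i with j | j <;> simp [g, mix, sub_eq_add_neg]
    simpa only [eval_bind₁_apply, hg] using h _
  refine MvPolynomial.funext fun v => ?_
  let x : Fin 2 ⊕ Fin 2 → ℂ :=
    Sum.elim (fun j => (v (Sum.inl j) + v (Sum.inr j)) / 2)
      (fun j => -I * (v (Sum.inl j) - v (Sum.inr j)) / 2)
  have hg : (fun i => eval x (g i)) = v := by
    funext i
    rcases i with j | j <;> simp only [g, x, Sum.elim_inl, Sum.elim_inr, map_add, map_sub,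
      map_mul, eval_X, eval_C]
    · linear_combination -(v (Sum.inl j) - v (Sum.inr j)) / 2 * I_sq
    · linear_combination (v (Sum.inl j) - v (Sum.inr j)) / 2 * I_sq
  simpa only [eval_bind₁_apply, hg] using congrArg (eval x) key

/-- The holomorphic polynomial `q(z)` as a polynomial in `z, z̄`. -/
def holo (q : P2) : P4 := rename Sum.inl q

/-- The conjugate of `q(z)` as a polynomial in `z, z̄`. -/
def antiholo (q : P2) : P4 := rename Sum.inr (map (starRingEnd ℂ) q)

theorem eval_mix_holo (z : Fin 2 → ℂ) (q : P2) : eval (mix z) (holo q) = eval z q := by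
  rw [holo, eval_rename]
  rfl

theorem eval_mix_antiholo (z : Fin 2 → ℂ) (q : P2) :
    eval (mix z) (antiholo q) = (starRingEnd ℂ) (eval z q) := by
  rw [antiholo, eval_rename, eval_map, ← coe_eval₂Hom, ← eval₂_id q, hom_eval₂]
  rfl

theorem pderiv_inl_holo (i : Fin 2) (q : P2) :
    pderiv (Sum.inl i) (holo q) = holo (pderiv i q) :=
  pderiv_rename Sum.inl_injective i q

theorem pderiv_inl_antiholo (i : Fin 2) (q : P2) :
    pderiv (Sum.inl i) (antiholo q) = 0 := by
  refine pderiv_eq_zero_of_notMem_vars fun h => ?_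
  classical
  simpa using vars_rename _ _ h

/-- The vector field `Y` acting on polynomials in `z, z̄` through the holomorphic variables. -/
def vfMix (f : Fin 2 → P2) : Derivation ℂ P4 P4 :=
  holo (f 0) • pderiv (Sum.inl 0) + holo (f 1) • pderiv (Sum.inl 1)

theorem vfMix_apply (f : Fin 2 → P2) (P : P4) :
    vfMix f P = holo (f 0) * pderiv (Sum.inl 0) P + holo (f 1) * pderiv (Sum.inl 1) P := rfl

theorem vfMix_holo (f : Fin 2 → P2) (q : P2) : vfMix f (holo q) = holo (vf f q) := by
  rw [vfMix_apply, pderiv_inl_holo, pderiv_inl_holo]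
  simp [vf, holo]

theorem vfMix_antiholo (f : Fin 2 → P2) (q : P2) : vfMix f (antiholo q) = 0 := by
  simp [vfMix_apply, pderiv_inl_antiholo]

/-- The pairing `Re (u(z) · conj (v(z)))` as a polynomial in `z, z̄`. -/
def rePair (u v : P2) : P4 :=
  C (1 / 2) * (holo u * antiholo v + antiholo u * holo v)

theorem eval_mix_rePair (z : Fin 2 → ℂ) (u v : P2) :
    eval (mix z) (rePair u v) = ((eval z u * (starRingEnd ℂ) (eval z v)).re : ℝ) := by
  simp only [rePair, map_mul, map_add, eval_C, eval_mix_holo, eval_mix_antiholo]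
  rw [re_eq_add_conj, map_mul, conj_conj]
  ring

theorem re_eval_mix_vfMix_rePair (f : Fin 2 → P2) (z : Fin 2 → ℂ) (u v : P2) :
    (eval (mix z) (vfMix f (rePair u v))).re =
      ((eval z (vf f u) * (starRingEnd ℂ) (eval z v)).re +
        (eval z u * (starRingEnd ℂ) (eval z (vf f v))).re) / 2 := by
  have h : vfMix f (rePair u v) =
      C (1 / 2) * (holo (vf f u) * antiholo v + antiholo u * holo (vf f v)) := by
    rw [rePair, ← smul_eq_C_mul, ← smul_eq_C_mul, Derivation.map_smul, map_add]
    simp only [Derivation.leibniz, vfMix_holo, vfMix_antiholo, smul_eq_mul]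
    rw [mul_zero, mul_zero, zero_add, add_zero, mul_comm (antiholo v)]
  simp only [h, map_mul, map_add, eval_C, eval_mix_holo, eval_mix_antiholo]
  simp
  ring

/-- Along a symmetric pair of chains the contributions of `Y` to the two factors cancel. -/
theorem sum_symmetric_chain_eq_zero (f : Fin 2 → P2) (n : ℕ) (U V : ℕ → P2) (c d : ℕ → ℂ)
    (hU : vf f (U (n + 1)) = 0) (hV : vf f (V (n + 1)) = 0)
    (hUc : ∀ k ∈ Finset.Icc 1 n, vf f (U k) = C (c k) * U (k + 1))
    (hVd : ∀ k ∈ Finset.Icc 1 n, vf f (V k) = C (d k) * V (k + 1))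
    (hcd : ∀ k ∈ Finset.Icc 1 n, c k = -(starRingEnd ℂ) (d (n + 1 - k))) (z : Fin 2 → ℂ) :
    ∑ k ∈ Finset.Icc 1 (n + 1), (eval z (vf f (U k)) *
        (starRingEnd ℂ) (eval z (V (n + 1 - k + 1))) +
      eval z (U k) * (starRingEnd ℂ) (eval z (vf f (V (n + 1 - k + 1))))) = 0 := by
  simp only [← Finset.Ico_add_one_right_eq_Icc, Finset.sum_Ico_eq_sum_range,
    add_tsub_cancel_right] at *
  rw [Finset.sum_add_distrib, Finset.sum_range_succ, Finset.sum_range_succ', add_comm 1 n,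
    hU, show n + 1 - (1 + 0) + 1 = n + 1 by omega, hV]
  simp only [map_zero, zero_mul, mul_zero, add_zero, ← Finset.sum_add_distrib]
  refine Finset.sum_eq_zero fun k hk => ?_
  have hk' := Finset.mem_range.1 hk
  rw [hUc (1 + k) (by simp; omega), hcd (1 + k) (by simp; omega),
    show n + 1 - (1 + (k + 1)) + 1 = n + 1 - (1 + k) by omega,
    hVd (n + 1 - (1 + k)) (by simp; omega), show 1 + (k + 1) = 1 + k + 1 by omega]
  simp only [map_mul, eval_C]
  ring

/-- conversely, if `P` is built from symmetric pairs of `Y`-chains,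
then `Y` is a generalized rotation of the model hypersurface `M_P`. -/
theorem stmt5 (μ : Fin 2 → ℚ) (hμ0 : 0 < μ 1) (hμ12 : μ 1 ≤ μ 0) (hμ1 : μ 0 ≤ 1 / 2)
    -- `Y = f₁ ∂/∂z₁ + f₂ ∂/∂z₂`, nonzero, weighted homogeneous of weighted degree `δ > 0`
    (f : Fin 2 → P2) (hf : f ≠ 0) (δ : ℚ) (hδ : 0 < δ)
    (hfhom : ∀ j, IsWeightedHomogeneous μ (f j) (μ j + δ))
    -- the chain data
    (M : ℕ) (hM : 1 ≤ M) (N : ℕ → ℕ) (hN : ∀ j, 1 ≤ j → j ≤ M → 1 ≤ N j)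
    (U V : ℕ → ℕ → P2) (cc dd : ℕ → ℕ → ℂ)
    -- the `U_j^k`, `V_j^k` are weighted homogeneous polynomials
    (hUhom : ∀ j, 1 ≤ j → j ≤ M → ∀ k, 1 ≤ k → k ≤ N j →
      ∃ a : ℚ, IsWeightedHomogeneous μ (U j k) a)
    (hVhom : ∀ j, 1 ≤ j → j ≤ M → ∀ k, 1 ≤ k → k ≤ N j →
      ∃ b : ℚ, IsWeightedHomogeneous μ (V j k) b)
    -- `{U_j^k}` and `{V_j^k}` form a symmetric pair of `Y`-chains:
    (hchainU : ∀ j, 1 ≤ j → j ≤ M → vf f (U j (N j)) = 0)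
    (hchainV : ∀ j, 1 ≤ j → j ≤ M → vf f (V j (N j)) = 0)
    (hchain : ∀ j, 1 ≤ j → j ≤ M → ∀ k, 1 ≤ k → k ≤ N j - 1 →
      cc j k ≠ 0 ∧ dd j k ≠ 0 ∧
      vf f (U j k) = C (cc j k) * U j (k + 1) ∧
      vf f (V j k) = C (dd j k) * V j (k + 1) ∧
      cc j k = - (starRingEnd ℂ) (dd j (N j - k)))
    -- `P(z,z̄) = Σ_j Re (Σ_k U_j^k(z) · conj (V_j^{N_j-k+1}(z)))`
    (P : P4)
    (hP : ∀ z : Fin 2 → ℂ,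
      eval (mix z) P =
        ((∑ j ∈ Finset.Icc 1 M,
            (∑ k ∈ Finset.Icc 1 (N j),
              eval z (U j k) * (starRingEnd ℂ) (eval z (V j (N j - k + 1)))).re : ℝ) : ℂ)) :
    -- then `Y` is tangent to `M_P`, i.e. a generalized rotation:
    ∀ z : Fin 2 → ℂ,
      (eval z (f 0) * eval (mix z) (pderiv (Sum.inl 0) P) +
       eval z (f 1) * eval (mix z) (pderiv (Sum.inl 1) P)).re = 0 := by
  intro z
  have hPQ : P = ∑ j ∈ Finset.Icc 1 M, ∑ k ∈ Finset.Icc 1 (N j),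
      rePair (U j k) (V j (N j - k + 1)) := by
    refine P4.ext_mix fun z => ?_
    simp only [hP, map_sum, eval_mix_rePair, re_sum, ofReal_sum]
  have hgoal : eval z (f 0) * eval (mix z) (pderiv (Sum.inl 0) P) +
      eval z (f 1) * eval (mix z) (pderiv (Sum.inl 1) P) = eval (mix z) (vfMix f P) := by
    simp only [vfMix_apply, map_add, map_mul, eval_mix_holo]
  rw [hgoal, hPQ]
  simp only [map_sum, re_sum, re_eval_mix_vfMix_rePair]
  refine Finset.sum_eq_zero fun j hj => ?_
  obtain ⟨h1, hM⟩ := Finset.mem_Icc.1 hj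
  obtain ⟨n, hn⟩ : ∃ n, N j = n + 1 := ⟨N j - 1, by have := hN j h1 hM; omega⟩
  have hc : ∀ k ∈ Finset.Icc 1 n, _ := fun k hk =>
    hchain j h1 hM k (Finset.mem_Icc.1 hk).1 (by have := (Finset.mem_Icc.1 hk).2; omega)
  have hU := hchainU j h1 hM
  have hV := hchainV j h1 hM
  rw [hn] at hU hV hc ⊢
  have hsum := congrArg re (sum_symmetric_chain_eq_zero f n (U j) (V j) (cc j) (dd j) hU hV
    (fun k hk => (hc k hk).2.2.1) (fun k hk => (hc k hk).2.2.2.1)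
    (fun k hk => (hc k hk).2.2.2.2) z)
  simp only [re_sum, add_re, zero_re] at hsum
  rw [← Finset.sum_div, hsum, zero_div]
end
end

section
/- Let P(z,z̄) be as in the model hypersurface M_P = {Im w = P(z,z̄)} (real-valued, weighted homogeneous of weighted degree 1 for weights μ = (μ₁,μ₂) with 0 < μ₂ ≤ μ₁ ≤ 1/2, without pluriharmonic terms). Let g₁, g₂, h ∈ ℂ[z₁,z₂] be such that g_j is weighted homogeneous of weighted degree μ_j + δ and h is weighted homogeneous of weighted degree 1 + δ, for some rational δ > 0, and suppose the rigid vector field X = g₁∂/∂z₁ + g₂∂/∂z₂ + h∂/∂w is tangent to M_P, i.e. Re( h(z)/(2i) − g₁(z)·∂P/∂z₁(z,z̄) − g₂(z)·∂P/∂z₂(z,z̄) ) = 0 for all z ∈ ℂ². Then h = 0, and consequently Re( g₁ ∂P/∂z₁ + g₂ ∂P/∂z₂ )(z,z̄) = 0 for all z ∈ ℂ². (Thus every rigid weighted homogeneous infinitesimal automorphism of M_P of positive weighted degree has vanishing ∂/∂w-component, i.e., if nonzero it is a generalized rotation.) -/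
open MvPolynomial Complex

noncomputable section

/-- Two-variable polarization: a polynomial vanishing at all points `(z, z̄)` vanishes
identically. -/
lemma eval_eq_zero_of_eval_mix_eq_zero (Q : P4)
    (hQ : ∀ z : Fin 2 → ℂ, eval (mix z) Q = 0) (v : Fin 2 ⊕ Fin 2 → ℂ) : eval v Q = 0 := by
  let φ : Fin 2 ⊕ Fin 2 → P4 := Sum.elim
    (fun j => X (Sum.inl j) + C I * X (Sum.inr j))
    (fun j => X (Sum.inl j) - C I * X (Sum.inr j))
  have hφ : bind₁ φ Q = 0 := by
    refine MvPolynomial.funext_set (fun _ => Set.range ((↑) : ℝ → ℂ))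
      (fun _ => Set.infinite_range_of_injective ofReal_injective) fun x hx => ?_
    have hx' : ∀ i, ∃ r : ℝ, (r : ℂ) = x i := fun i => hx i (Set.mem_univ i)
    choose r hr using hx'
    have hpt : (fun i => eval x (φ i)) = mix (fun j => x (Sum.inl j) + I * x (Sum.inr j)) := by
      funext i
      rcases i with j | j
      · simp [φ, mix]
      · simp [φ, mix, ← hr, sub_eq_add_neg]
    rw [map_zero, ← hQ (fun j => x (Sum.inl j) + I * x (Sum.inr j)), ← hpt]
    exact eval₂Hom_bind₁ _ _ _ _
  have hv : (fun i => eval (Sum.elim (fun j => (v (Sum.inl j) + v (Sum.inr j)) / 2)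
      (fun j => (v (Sum.inl j) - v (Sum.inr j)) / (2 * I))) (φ i)) = v := by
    funext i
    rcases i with j | j <;> simp [φ] <;> field_simp <;> ring
  have key := congrArg (eval (Sum.elim (fun j => (v (Sum.inl j) + v (Sum.inr j)) / 2)
      (fun j => (v (Sum.inl j) - v (Sum.inr j)) / (2 * I)))) hφ
  rw [map_zero] at key
  rw [← key]
  conv_lhs => rw [← hv]
  exact (eval₂Hom_bind₁ _ _ _ _).symm

/-- The conjugate polynomial `(z, z̄) ↦ conj (R (z, z̄))`. -/
def conjPoly (R : P4) : P4 := rename Sum.swap (map (starRingEnd ℂ) R)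

lemma eval_conjPoly (R : P4) (v w : Fin 2 → ℂ) :
    eval (Sum.elim v w) (conjPoly R) =
      (starRingEnd ℂ) (eval (Sum.elim (fun j => (starRingEnd ℂ) (w j))
        (fun j => (starRingEnd ℂ) (v j))) R) := by
  induction R using MvPolynomial.induction_on with
  | C a => simp [conjPoly]
  | add p q hp hq => simp only [conjPoly, map_add] at *; rw [hp, hq]
  | mul_X p i hp =>
    simp only [conjPoly, map_mul] at *
    rw [hp]
    rcases i with j | j <;> simp

/-- If every monomial of `P` contains an antiholomorphic variable, then the holomorphic
derivatives of `P` vanish where `z̄ = 0`. -/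
lemma eval_pderiv_inl_eq_zero (P : P4) (hP : ∀ m ∈ P.support, ∃ i, m (Sum.inr i) ≠ 0)
    (j : Fin 2) (z : Fin 2 → ℂ) :
    eval (Sum.elim z (fun _ => 0)) (pderiv (Sum.inl j) P) = 0 := by
  rw [P.as_sum, map_sum, map_sum]
  refine Finset.sum_eq_zero fun m hm => ?_
  obtain ⟨i, hi⟩ := hP m hm
  rw [pderiv_monomial, eval_monomial]
  refine mul_eq_zero_of_right _ (Finset.prod_eq_zero (i := Sum.inr i) ?_ ?_)
  · simpa using hi
  · simpa using hi

lemma constantCoeff_eq_zero_of_isWeightedHomogeneous {μ : Fin 2 → ℚ} {q : P2} {κ : ℚ} (hκ : 0 < κ)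
    (hq : IsWeightedHomogeneous μ q κ) : constantCoeff q = 0 := by
  rw [constantCoeff_eq]
  by_contra hne
  have := hq hne
  rw [map_zero] at this
  exact hκ.ne this

/-- a rigid weighted homogeneous infinitesimal automorphism
`X = g₁ ∂/∂z₁ + g₂ ∂/∂z₂ + h ∂/∂w` of `M_P` of positive weighted degree `δ`
has vanishing `∂/∂w`-component, i.e. `h = 0`; consequently
`Re (g₁ ∂P/∂z₁ + g₂ ∂P/∂z₂) = 0`. -/
theorem stmt12 (μ : Fin 2 → ℚ) (hμ0 : 0 < μ 1) (hμ12 : μ 1 ≤ μ 0) (hμ1 : μ 0 ≤ 1 / 2)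
    (P : P4)
    (hreal : ∀ z : Fin 2 → ℂ, (eval (mix z) P).im = 0)
    (hPhom : IsWeightedHomogeneous (Sum.elim μ μ) P 1)
    (hplh : ∀ m ∈ P.support, (∃ i, m (Sum.inl i) ≠ 0) ∧ (∃ i, m (Sum.inr i) ≠ 0))
    -- the coefficients of the rigid field `X = g₁∂/∂z₁ + g₂∂/∂z₂ + h∂/∂w`:
    (g : Fin 2 → P2) (h : P2) (δ : ℚ) (hδ : 0 < δ)
    (hghom : ∀ j, IsWeightedHomogeneous μ (g j) (μ j + δ))
    (hhhom : IsWeightedHomogeneous μ h (1 + δ))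
    -- `X` is tangent to `M_P`:
    (htan : ∀ z : Fin 2 → ℂ,
      (eval z h / (2 * Complex.I)
        - eval z (g 0) * eval (mix z) (pderiv (Sum.inl 0) P)
        - eval z (g 1) * eval (mix z) (pderiv (Sum.inl 1) P)).re = 0) :
    h = 0 ∧
      ∀ z : Fin 2 → ℂ,
        (eval z (g 0) * eval (mix z) (pderiv (Sum.inl 0) P) +
         eval z (g 1) * eval (mix z) (pderiv (Sum.inl 1) P)).re = 0 := by
  have hμpos : ∀ j, 0 < μ j := by
    intro j
    fin_cases j
    · exact hμ0.trans_le hμ12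
    · exact hμ0
  let F : P4 := rename Sum.inl h * C (1 / (2 * I))
    - rename Sum.inl (g 0) * pderiv (Sum.inl 0) P
    - rename Sum.inl (g 1) * pderiv (Sum.inl 1) P
  have hF : ∀ v w : Fin 2 → ℂ, eval (Sum.elim v w) F = eval v h / (2 * I)
      - eval v (g 0) * eval (Sum.elim v w) (pderiv (Sum.inl 0) P)
      - eval v (g 1) * eval (Sum.elim v w) (pderiv (Sum.inl 1) P) := by
    intro v w
    simp only [F, map_sub, map_mul, eval_rename, eval_C, Sum.elim_comp_inl]
    ring
  have hpol : ∀ v, eval v (F + conjPoly F) = 0 := by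
    refine eval_eq_zero_of_eval_mix_eq_zero _ fun z => ?_
    have hz := htan z
    unfold mix at hz ⊢
    rw [map_add, eval_conjPoly]
    simp only [Complex.conj_conj]
    rw [Complex.add_conj, hF, hz]
    simp
  have hh : h = 0 := by
    refine MvPolynomial.funext fun z => ?_
    have hz := hpol (Sum.elim z (fun _ => 0))
    have hh0 := constantCoeff_eq_zero_of_isWeightedHomogeneous (by linarith) hhhom
    have hg0 : ∀ j, constantCoeff (g j) = 0 := fun j =>
      constantCoeff_eq_zero_of_isWeightedHomogeneous (add_pos (hμpos j) hδ) (hghom j)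
    have hP0 := eval_pderiv_inl_eq_zero P fun m hm => (hplh m hm).2
    rw [map_add, eval_conjPoly, hF, hF] at hz
    simpa [hh0, hg0, hP0] using hz
  refine ⟨hh, fun z => ?_⟩
  have hz := htan z
  simp only [hh, map_zero, zero_div, sub_re, zero_re] at hz
  rw [add_re]
  linarith
end
end

section
/- Let Y = z₁²∂/∂z₁ − z₁z₂∂/∂z₂, a weighted homogeneous holomorphic polynomial vector field of weighted degree 1 for the weights λ₁ = λ₂ = 1, acting on ℂ[z₁,z₂] by Y(q) = z₁² ∂q/∂z₁ − z₁z₂ ∂q/∂z₂. Then for all integers 1 ≤ l ≤ n there exist nonzero complex constants γ₁,…,γ_l such that the polynomials Uʲ := γ_j · z₁^{n−l+j} z₂^{n} (j = 1,…,l) form a symmetric Y-chain of length l; that is, Y(U^l) = 0 and there exist nonzero complex constants c₁,…,c_{l−1} with Y(Uʲ) = c_j U^{j+1} for j = 1,…,l−1 and c_j = −conj(c_{l−j}). -/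
open MvPolynomial Complex

noncomputable section

/-- The vector field `Y = z₁² ∂/∂z₁ − z₁ z₂ ∂/∂z₂`. -/
def Yex : Fin 2 → P2 := ![X 0 ^ 2, -(X 0 * X 1)]

/-- The field `Y` multiplies `z₁^m z₂^n` by `(m - n) z₁`. -/
theorem vf_Yex_monomial (a : ℂ) (m n : ℕ) :
    vf Yex (C a * X 0 ^ m * X 1 ^ n) = C (a * (m - n)) * X 0 ^ (m + 1) * X 1 ^ n := by
  have h0 : pderiv 0 (C a * X 0 ^ m * X 1 ^ n : P2)
      = C a * ((m : P2) * X 0 ^ (m - 1)) * X 1 ^ n := by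
    simp [Derivation.leibniz, Derivation.leibniz_pow]
    ring
  have h1 : pderiv 1 (C a * X 0 ^ m * X 1 ^ n : P2)
      = C a * X 0 ^ m * ((n : P2) * X 1 ^ (n - 1)) := by
    simp [Derivation.leibniz, Derivation.leibniz_pow]
  have hpow (i : Fin 2) (k : ℕ) : (k : P2) * X i ^ (k - 1) * X i = (k : P2) * X i ^ k := by
    cases k <;> simp [pow_succ, mul_assoc]
  have hm := hpow 0 m
  have hn := hpow 1 n
  simp only [vf, Yex, h0, h1, Matrix.cons_val_zero, Matrix.cons_val_one, map_mul, map_sub,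
    map_natCast]
  linear_combination C a * X 0 * X 1 ^ n * hm - C a * X 0 ^ (m + 1) * hn

/-- for `Y = z₁²∂/∂z₁ − z₁z₂∂/∂z₂` and all `1 ≤ l ≤ n` there are
nonzero constants `γ₁,…,γ_l` such that `Uʲ = γ_j z₁^{n-l+j} z₂^n`, `j = 1,…,l`,
form a symmetric `Y`-chain of length `l`: `Y(U^l) = 0` and `Y(Uʲ) = c_j U^{j+1}`
with nonzero `c_j` satisfying `c_j = -conj (c_{l-j})`. -/
theorem stmt13 (n l : ℕ) (hl : 1 ≤ l) (hln : l ≤ n) :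
    ∃ γ : ℕ → ℂ,
      (∀ j, 1 ≤ j → j ≤ l → γ j ≠ 0) ∧
      vf Yex (C (γ l) * X 0 ^ n * X 1 ^ n) = 0 ∧
      ∃ c : ℕ → ℂ, ∀ j, 1 ≤ j → j ≤ l - 1 →
        c j ≠ 0 ∧
        vf Yex (C (γ j) * X 0 ^ (n - l + j) * X 1 ^ n)
          = C (c j) * (C (γ (j + 1)) * X 0 ^ (n - l + j + 1) * X 1 ^ n) ∧
        c j = - (starRingEnd ℂ) (c (l - j)) := by
  refine ⟨fun j => ∏ k ∈ Finset.range j, ((k : ℂ) - l) * (-I), ?_, ?_, fun _ => I, ?_⟩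
  · intro j _ hj
    refine Finset.prod_ne_zero_iff.mpr fun k hk => mul_ne_zero ?_ (neg_ne_zero.mpr I_ne_zero)
    rw [sub_ne_zero, Ne, Nat.cast_inj]
    have := Finset.mem_range.mp hk
    omega
  · rw [vf_Yex_monomial]
    simp
  · intro j _ _
    refine ⟨I_ne_zero, ?_, by simp⟩
    beta_reduce
    rw [vf_Yex_monomial, ← mul_assoc, ← mul_assoc, ← C_mul, Finset.prod_range_succ]
    congr 3
    push_cast [Nat.cast_sub hln]
    linear_combination
      (∏ k ∈ Finset.range j, ((k : ℂ) - l) * (-I)) * ((j : ℂ) - l) * I_mul_I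
end
end
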